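/- arXiv:2405.06597 — 2 statements merged into one kernel-verified Lean document; each statement's English description precedes it below -/
import Mathlib

section
/- Yang–Baxterization identity: the spectral-parameter-dependent R-matrix of type C_n^{(1)} is obtained from the basic R-matrix by R̄(z) = r^{1/2}s^{1/2}·((z−1)/(zr−s))·R + ((r−s)/(zr−s))·P − ((r−s)(z−1)r^{−n−1}s^{n+1}/((zr−s)(z−r^{−n−1}s^{n+1})))·Q, where P = Σ_{i,j=1}^{2n}E_{ij}⊗E_{ji} and Q = Σ_{i,j=1}^{2n}(r^{1/2}s^{−1/2})^{ī−j̄}ε_iε_jE_{i′j′}⊗E_{ij}. -/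
noncomputable section

open Finset
open scoped Kronecker

set_option maxHeartbeats 1000000

abbrev K : Type := FractionRing (MvPolynomial (Fin 3) ℚ)

def ρ : K := algebraMap (MvPolynomial (Fin 3) ℚ) K (MvPolynomial.X 0)
def σ' : K := algebraMap (MvPolynomial (Fin 3) ℚ) K (MvPolynomial.X 1)
def r : K := ρ ^ 2
def s : K := σ' ^ 2
def zVar : K := algebraMap (MvPolynomial (Fin 3) ℚ) K (MvPolynomial.X 2)

abbrev M (n : ℕ) := Matrix (Fin (2*n)) (Fin (2*n)) K
abbrev M2 (n : ℕ) := Matrix (Fin (2*n) × Fin (2*n)) (Fin (2*n) × Fin (2*n)) K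

/-- the matrix unit `E_{kl}` (1-based indices). -/
def E (n k l : ℕ) : M n :=
  Matrix.of fun a b => if a.val + 1 = k ∧ b.val + 1 = l then (1 : K) else 0

def eMat (n i : ℕ) : M n :=
  if i = n then (ρ⁻¹ * σ'⁻¹) • E n (n+1) n
  else (ρ⁻¹ * σ'⁻¹) • E n (i+1) i - E n (2*n-i+1) (2*n-i)

def fMat (n i : ℕ) : M n :=
  if i = n then (ρ⁻¹ * σ'⁻¹) • E n n (n+1)
  else (ρ⁻¹ * σ'⁻¹) • E n i (i+1) - E n (2*n-i) (2*n-i+1)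

def ωMat (n i : ℕ) : M n :=
  if i = n then
    ∑ j ∈ Icc 1 (2*n),
      (if j ≤ n - 1 then r * s else if j = n then r⁻¹ * s else if j = n + 1 then r * s⁻¹
       else r⁻¹ * s⁻¹) • E n j j
  else
    ∑ j ∈ Icc 1 (2*n),
      (if j = i then r⁻¹ else if j = i + 1 then s⁻¹ else if j = 2*n - i then s
       else if j = 2*n - i + 1 then r else 1) • E n j j

def ω'Mat (n i : ℕ) : M n :=
  if i = n then
    ∑ j ∈ Icc 1 (2*n),
      (if j ≤ n - 1 then r * s else if j = n then r * s⁻¹ else if j = n + 1 then r⁻¹ * s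
       else r⁻¹ * s⁻¹) • E n j j
  else
    ∑ j ∈ Icc 1 (2*n),
      (if j = i then s⁻¹ else if j = i + 1 then r⁻¹ else if j = 2*n - i then r
       else if j = 2*n - i + 1 then s else 1) • E n j j

/-- `ī` for `1 ≤ i ≤ 2n`. -/
def bar (n i : ℕ) : ℤ := if i ≤ n then (n : ℤ) + 1 - i else (n : ℤ) - i

/-- `ε_i` for `1 ≤ i ≤ 2n`. -/
def sg (n i : ℕ) : K := if i ≤ n then 1 else -1

def S1 (n : ℕ) : M2 n :=
  (∑ i ∈ Icc 1 (n-1), ∑ j ∈ Icc (i+1) n, E n i i ⊗ₖ E n j j)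
  + (∑ i ∈ Icc 1 (n-1), ∑ j ∈ Icc (2*n+1-i+1) (2*n), E n i i ⊗ₖ E n j j)
  + (∑ j ∈ Icc (n+2) (2*n), E n n n ⊗ₖ E n j j)
  + (∑ j ∈ Icc (n+1) (2*n-1), ∑ i ∈ Icc (j+1) (2*n), E n i i ⊗ₖ E n j j)
  + (∑ i ∈ Icc 1 (n-1), ∑ j ∈ Icc (n+1) (2*n-i), E n j j ⊗ₖ E n i i)

def S2 (n : ℕ) : M2 n :=
  (∑ i ∈ Icc 1 (n-1), ∑ j ∈ Icc (i+1) n, E n j j ⊗ₖ E n i i)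
  + (∑ i ∈ Icc 1 (n-1), ∑ j ∈ Icc (2*n+1-i+1) (2*n), E n j j ⊗ₖ E n i i)
  + (∑ j ∈ Icc (n+2) (2*n), E n j j ⊗ₖ E n n n)
  + (∑ j ∈ Icc (n+1) (2*n-1), ∑ i ∈ Icc (j+1) (2*n), E n j j ⊗ₖ E n i i)
  + (∑ i ∈ Icc 1 (n-1), ∑ j ∈ Icc (n+1) (2*n-i), E n i i ⊗ₖ E n j j)

/-- The basic quantum `R`-matrix of type `C_n`. -/
def RMat (n : ℕ) : M2 n :=
  (ρ * σ'⁻¹) • (∑ i ∈ Icc 1 (2*n), E n i i ⊗ₖ E n i i)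
  + (ρ⁻¹ * σ') • (∑ i ∈ Icc 1 (2*n), E n i i ⊗ₖ E n (2*n+1-i) (2*n+1-i))
  + (ρ * σ') • S1 n
  + (ρ⁻¹ * σ'⁻¹) • S2 n
  + (ρ * σ'⁻¹ - ρ⁻¹ * σ') •
      ((∑ i ∈ Icc 1 (2*n), ∑ j ∈ Icc (i+1) (2*n), E n i j ⊗ₖ E n j i)
        - ∑ i ∈ Icc 1 (2*n), ∑ j ∈ Icc 1 (i-1),
            ((ρ * σ'⁻¹) ^ (bar n i - bar n j) * sg n i * sg n j) •
              (E n (2*n+1-i) (2*n+1-j) ⊗ₖ E n i j))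

/-- The permutation matrix `P`. -/
def Pmat (n : ℕ) : M2 n := ∑ i ∈ Icc 1 (2*n), ∑ j ∈ Icc 1 (2*n), E n i j ⊗ₖ E n j i

def nExp (n : ℕ) : K := r ^ (-(n : ℤ) - 1) * s ^ ((n : ℤ) + 1)

/-- coefficients `a_{ij}(z)`. -/
def aC (n : ℕ) (z : K) (i j : ℕ) : K :=
  if i = j then (z - 1) * (r⁻¹ * s * z - nExp n)
  else if j < i then
    (r⁻¹ * s - 1) * z * ((ρ * σ'⁻¹) ^ (bar n i - bar n j) * sg n i * sg n j * (z - 1)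
      - (if i = 2*n + 1 - j then 1 else 0) * (z - nExp n))
  else
    (r⁻¹ * s - 1) * ((ρ * σ'⁻¹) ^ (bar n i - bar n j) * sg n i * sg n j * nExp n * (z - 1)
      - (if i = 2*n + 1 - j then 1 else 0) * (z - nExp n))

/-- The spectral-parameter-dependent `R`-matrix of type `C_n^{(1)}`. -/
def Rbar (n : ℕ) (z : K) : M2 n :=
  (∑ i ∈ Icc 1 (2*n), E n i i ⊗ₖ E n i i)
  + (r * s * (z - 1) / (z * r - s)) • S1 n
  + ((z - 1) / (z * r - s)) • S2 n
  + ((r - s) / (z * r - s)) •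
      (∑ i ∈ Icc 1 (2*n), ∑ j ∈ Icc 1 (i-1), if i ≠ 2*n + 1 - j then E n i j ⊗ₖ E n j i else 0)
  + ((r - s) * z / (z * r - s)) •
      (∑ i ∈ Icc 1 (2*n), ∑ j ∈ Icc (i+1) (2*n), if i ≠ 2*n + 1 - j then E n i j ⊗ₖ E n j i else 0)
  + (1 / ((z - r⁻¹ * s) * (z - nExp n))) •
      (∑ i ∈ Icc 1 (2*n), ∑ j ∈ Icc 1 (2*n), aC n z i j • (E n (2*n+1-i) (2*n+1-j) ⊗ₖ E n i j))

def Qmat (n : ℕ) : M2 n :=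
  ∑ i ∈ Icc 1 (2*n), ∑ j ∈ Icc 1 (2*n),
    ((ρ * σ'⁻¹) ^ (bar n i - bar n j) * sg n i * sg n j) •
      (E n (2*n+1-i) (2*n+1-j) ⊗ₖ E n i j)

theorem split_sum {A : Type*} [AddCommMonoid A] (m : ℕ) (f : ℕ → ℕ → A) :
    ∑ i ∈ Icc 1 m, ∑ j ∈ Icc 1 m, f i j
      = (∑ i ∈ Icc 1 m, f i i) + (∑ i ∈ Icc 1 m, ∑ j ∈ Icc 1 (i-1), f i j)
        + (∑ i ∈ Icc 1 m, ∑ j ∈ Icc (i+1) m, f i j) := by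
  rw [← sum_add_distrib, ← sum_add_distrib]
  refine sum_congr rfl fun i hi => ?_
  rw [mem_Icc] at hi
  have h : Icc 1 m = insert i (Icc 1 (i-1) ∪ Icc (i+1) m) := by
    ext x; simp only [mem_Icc, mem_insert, mem_union]; omega
  rw [h, sum_insert (by simp only [mem_Icc, mem_union]; omega), sum_union, add_assoc]
  rw [disjoint_left]
  intro x; simp only [mem_Icc]; omega

theorem swap_sum {A : Type*} [AddCommMonoid A] (m : ℕ) (f : ℕ → ℕ → A) :
    ∑ i ∈ Icc 1 m, ∑ j ∈ Icc 1 (i-1), f i j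
      = ∑ i ∈ Icc 1 m, ∑ j ∈ Icc (i+1) m, f j i := by
  apply sum_comm'
  intro x y; simp only [mem_Icc]; omega

theorem refl_sum {A : Type*} [AddCommMonoid A] (m : ℕ) (f : ℕ → ℕ → A) :
    ∑ i ∈ Icc 1 m, f i (m+1-i) = ∑ i ∈ Icc 1 m, f (m+1-i) i := by
  refine sum_bij' (fun i _ => m+1-i) (fun i _ => m+1-i) ?_ ?_ ?_ ?_ ?_
  all_goals intro i hi; rw [mem_Icc] at hi
  · simp only [mem_Icc]; omega
  · simp only [mem_Icc]; omega
  · show m+1-(m+1-i) = i; omega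
  · show m+1-(m+1-i) = i; omega
  · rw [show m+1-(m+1-i) = i by omega]

theorem ite_split (n i j : ℕ) (X : M2 n) (p : Prop) [Decidable p] :
    X = (if ¬ p then X else 0) + (if p then X else 0) := by
  split_ifs <;> simp

theorem zden1 : zVar * r - s ≠ 0 := by
  intro h
  have h2 : algebraMap (MvPolynomial (Fin 3) ℚ) K
      (MvPolynomial.X 2 * MvPolynomial.X 0 ^ 2 - MvPolynomial.X 1 ^ 2) = 0 := by
    simpa [zVar, r, s, ρ, σ'] using h
  rw [FaithfulSMul.algebraMap_eq_zero_iff] at h2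
  have := congrArg (MvPolynomial.eval ![1, 1, 0]) h2
  simp at this

theorem rho_ne : ρ ≠ 0 := by
  intro h
  rw [ρ, FaithfulSMul.algebraMap_eq_zero_iff] at h
  exact MvPolynomial.X_ne_zero _ h

theorem sigma_ne : σ' ≠ 0 := by
  intro h
  rw [σ', FaithfulSMul.algebraMap_eq_zero_iff] at h
  exact MvPolynomial.X_ne_zero _ h

theorem zden2 (n : ℕ) : zVar - nExp n ≠ 0 := by
  intro h
  have h1 : zVar * r ^ (n+1) - s ^ (n+1) = 0 := by
    have hr : r ≠ 0 := pow_ne_zero 2 rho_ne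
    have e : nExp n = s ^ (n+1) / r ^ (n+1) := by
      rw [nExp, show -(n:ℤ) - 1 = -((n+1 : ℕ) : ℤ) by push_cast; ring,
        show (n:ℤ) + 1 = ((n+1 : ℕ) : ℤ) by push_cast; ring, zpow_neg, zpow_natCast, zpow_natCast]
      rw [div_eq_mul_inv, mul_comm]
    rw [sub_eq_zero.mp h, e, div_mul_cancel₀ _ (pow_ne_zero _ hr), sub_self]
  have h2 : algebraMap (MvPolynomial (Fin 3) ℚ) K
      (MvPolynomial.X 2 * (MvPolynomial.X 0 ^ 2) ^ (n+1) - (MvPolynomial.X 1 ^ 2) ^ (n+1)) = 0 := by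
    simpa [zVar, r, s, ρ, σ'] using h1
  rw [FaithfulSMul.algebraMap_eq_zero_iff] at h2
  have := congrArg (MvPolynomial.eval ![1, 1, 0]) h2
  simp at this

/-- strictly upper part restricted to `i = j'`. -/
def Ud (n : ℕ) : M2 n :=
  ∑ i ∈ Icc 1 (2*n), ∑ j ∈ Icc (i+1) (2*n), if i = 2*n+1-j then E n i j ⊗ₖ E n j i else 0

def Ld (n : ℕ) : M2 n :=
  ∑ i ∈ Icc 1 (2*n), ∑ j ∈ Icc 1 (i-1), if i = 2*n+1-j then E n i j ⊗ₖ E n j i else 0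

theorem U_split (n : ℕ) :
    (∑ i ∈ Icc 1 (2*n), ∑ j ∈ Icc (i+1) (2*n), E n i j ⊗ₖ E n j i)
    = (∑ i ∈ Icc 1 (2*n), ∑ j ∈ Icc (i+1) (2*n),
        if i ≠ 2*n+1-j then E n i j ⊗ₖ E n j i else 0) + Ud n := by
  simp only [Ud, ← sum_add_distrib]
  refine sum_congr rfl fun i _ => sum_congr rfl fun j _ => ite_split n i j _ _

theorem L_split (n : ℕ) :
    (∑ i ∈ Icc 1 (2*n), ∑ j ∈ Icc 1 (i-1), E n i j ⊗ₖ E n j i)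
    = (∑ i ∈ Icc 1 (2*n), ∑ j ∈ Icc 1 (i-1),
        if i ≠ 2*n+1-j then E n i j ⊗ₖ E n j i else 0) + Ld n := by
  simp only [Ld, ← sum_add_distrib]
  refine sum_congr rfl fun i _ => sum_congr rfl fun j _ => ite_split n i j _ _

theorem Ud_eq (n : ℕ) :
    ∑ i ∈ Icc 1 (2*n), ∑ j ∈ Icc 1 (i-1),
      (if i = 2*n+1-j then (1:K) else 0) • (E n (2*n+1-i) (2*n+1-j) ⊗ₖ E n i j) = Ud n := by
  rw [swap_sum, Ud]
  refine sum_congr rfl fun i hi => sum_congr rfl fun j hj => ?_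
  rw [mem_Icc] at hi hj
  by_cases h : i = 2*n+1-j
  · have h' : j = 2*n+1-i := by omega
    rw [if_pos h, if_pos h', one_smul, ← h, ← h']
  · rw [if_neg h, if_neg (by omega), zero_smul]

theorem Ld_eq (n : ℕ) :
    ∑ i ∈ Icc 1 (2*n), ∑ j ∈ Icc (i+1) (2*n),
      (if i = 2*n+1-j then (1:K) else 0) • (E n (2*n+1-i) (2*n+1-j) ⊗ₖ E n i j) = Ld n := by
  rw [Ld, swap_sum]
  refine sum_congr rfl fun i hi => sum_congr rfl fun j hj => ?_
  rw [mem_Icc] at hi hj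
  by_cases h : i = 2*n+1-j
  · have h' : j = 2*n+1-i := by omega
    rw [if_pos h, if_pos h', one_smul, ← h, ← h']
  · rw [if_neg h, if_neg (by omega), zero_smul]

def Dd (n : ℕ) : M2 n := ∑ i ∈ Icc 1 (2*n), E n i i ⊗ₖ E n (2*n+1-i) (2*n+1-i)

theorem Dd_eq (n : ℕ) :
    ∑ i ∈ Icc 1 (2*n), E n (2*n+1-i) (2*n+1-i) ⊗ₖ E n i i = Dd n :=
  (refl_sum (2*n) (fun i j => E n i i ⊗ₖ E n j j)).symm

def Ql (n : ℕ) : M2 n :=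
  ∑ i ∈ Icc 1 (2*n), ∑ j ∈ Icc 1 (i-1),
    ((ρ * σ'⁻¹) ^ (bar n i - bar n j) * sg n i * sg n j) •
      (E n (2*n+1-i) (2*n+1-j) ⊗ₖ E n i j)

def Qu (n : ℕ) : M2 n :=
  ∑ i ∈ Icc 1 (2*n), ∑ j ∈ Icc (i+1) (2*n),
    ((ρ * σ'⁻¹) ^ (bar n i - bar n j) * sg n i * sg n j) •
      (E n (2*n+1-i) (2*n+1-j) ⊗ₖ E n i j)

theorem Q_split (n : ℕ) : Qmat n = Dd n + Ql n + Qu n := by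
  rw [Qmat, split_sum, Ql, Qu, ← Dd_eq]
  congr 2
  refine sum_congr rfl fun i _ => ?_
  have : sg n i * sg n i = 1 := by unfold sg; split_ifs <;> norm_num
  rw [sub_self, zpow_zero, one_mul, this, one_smul]

theorem A_split (n : ℕ) (z : K) :
    (∑ i ∈ Icc 1 (2*n), ∑ j ∈ Icc 1 (2*n), aC n z i j • (E n (2*n+1-i) (2*n+1-j) ⊗ₖ E n i j))
    = ((z - 1) * (r⁻¹ * s * z - nExp n)) • Dd n
      + (((r⁻¹ * s - 1) * z * (z - 1)) • Ql n - ((r⁻¹ * s - 1) * z * (z - nExp n)) • Ud n)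
      + (((r⁻¹ * s - 1) * nExp n * (z - 1)) • Qu n - ((r⁻¹ * s - 1) * (z - nExp n)) • Ld n) := by
  rw [split_sum, ← Dd_eq, ← Ud_eq, ← Ld_eq, Ql, Qu]
  simp only [smul_sum, ← sum_sub_distrib]
  congr 1
  · congr 1
    · refine sum_congr rfl fun i _ => ?_
      rw [aC, if_pos rfl]
    · refine sum_congr rfl fun i hi => sum_congr rfl fun j hj => ?_
      rw [mem_Icc] at hi hj
      rw [aC, if_neg (by omega), if_pos (by omega), smul_smul, smul_smul, ← sub_smul]
      congr 1; ring
  · refine sum_congr rfl fun i hi => sum_congr rfl fun j hj => ?_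
    rw [mem_Icc] at hi hj
    rw [aC, if_neg (by omega), if_neg (by omega), smul_smul, smul_smul, ← sub_smul]
    congr 1; ring

/-- Yang–Baxterization of the basic `R`-matrix. -/
theorem stmt10 (n : ℕ) (hn : 2 ≤ n) :
    Rbar n zVar
      = (ρ * σ' * ((zVar - 1) / (zVar * r - s))) • RMat n
        + ((r - s) / (zVar * r - s)) • Pmat n
        - ((r - s) * (zVar - 1) * nExp n / ((zVar * r - s) * (zVar - nExp n))) • Qmat n := by
  have hz1 := zden1
  have hz2 := zden2 n
  have hρ := rho_ne
  have hσ := sigma_ne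
  have hr : r ≠ 0 := pow_ne_zero 2 rho_ne
  have e1 : zVar - r⁻¹ * s = (zVar * r - s) / r := by field_simp
  have e2 : r⁻¹ * s - 1 = - ((r - s) / r) := by field_simp; ring
  have e3 : r⁻¹ * s * zVar - nExp n = (s * zVar - r * nExp n) / r := by field_simp
  have er : r = ρ ^ 2 := rfl
  have es : s = σ' ^ 2 := rfl
  rw [Rbar, RMat, Pmat, A_split, Q_split, split_sum, U_split, L_split, ← Dd, ← Ql, e1, e2, e3]
  generalize (∑ i ∈ Icc 1 (2*n), E n i i ⊗ₖ E n i i) = D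
  generalize (∑ i ∈ Icc 1 (2*n), ∑ j ∈ Icc (i+1) (2*n),
        if i ≠ 2*n+1-j then E n i j ⊗ₖ E n j i else 0) = U
  generalize (∑ i ∈ Icc 1 (2*n), ∑ j ∈ Icc 1 (i-1),
        if i ≠ 2*n+1-j then E n i j ⊗ₖ E n j i else 0) = L
  ext a b
  simp only [Matrix.add_apply, Matrix.sub_apply, Matrix.smul_apply, smul_eq_mul]
  generalize D a b = D
  generalize U a b = U
  generalize L a b = L
  generalize Dd n a b = D'
  generalize Ql n a b = ql
  generalize Qu n a b = qu
  generalize Ud n a b = ud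
  generalize Ld n a b = ld
  generalize S1 n a b = s1
  generalize S2 n a b = s2
  clear e1 e2 e3
  rw [er, es] at hz1 ⊢
  clear er es hr
  generalize nExp n = N at *
  generalize zVar = z at *
  generalize ρ = x at *
  generalize σ' = y at *
  have hz3 : z * x ^ 2 - y ^ 2 ≠ 0 := hz1
  have hz4 : x ^ 2 * z - y ^ 2 ≠ 0 := by rwa [mul_comm]
  field_simp
  ring

end
end

section
/- The type-A block of the spectral C-type R-matrix: for all 1 ≤ i, j, k, l ≤ n, the coefficient of E_{ij}⊗E_{kl} in R̄(z) equals the coefficient of e_{ij}⊗e_{kl} in the n²×n² matrix R′(z) = Σ_{i=1}^{n}e_{ii}⊗e_{ii} + ((1−z)s^{−1}/(1−zrs^{−1}))Σ_{i>j}e_{ii}⊗e_{jj} + ((1−z)r/(1−zrs^{−1}))Σ_{i<j}e_{ii}⊗e_{jj} + ((1−rs^{−1})/(1−zrs^{−1}))Σ_{i>j}e_{ij}⊗e_{ji} + ((1−rs^{−1})z/(1−zrs^{−1}))Σ_{i<j}e_{ij}⊗e_{ji}, where e_{kl} denote the n×n matrix units; equivalently, the submatrix of R̄(z) on rows and columns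 indexed by pairs in {1,…,n}×{1,…,n} equals R′(z). -/
noncomputable section

open Finset
open scoped Kronecker

set_option maxHeartbeats 1000000

def E' (n k l : ℕ) : Matrix (Fin n) (Fin n) K :=
  Matrix.of fun a b => if a.val + 1 = k ∧ b.val + 1 = l then (1 : K) else 0

/-- the type-`A` two-parameter `R`-matrix `R'(z)`. -/
def R'A (n : ℕ) (z : K) : Matrix (Fin n × Fin n) (Fin n × Fin n) K :=
  (∑ i ∈ Icc 1 n, E' n i i ⊗ₖ E' n i i)
  + ((1 - z) * s⁻¹ / (1 - z * r * s⁻¹)) • (∑ i ∈ Icc 1 n, ∑ j ∈ Icc 1 (i-1), E' n i i ⊗ₖ E' n j j)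
  + ((1 - z) * r / (1 - z * r * s⁻¹)) • (∑ i ∈ Icc 1 n, ∑ j ∈ Icc (i+1) n, E' n i i ⊗ₖ E' n j j)
  + ((1 - r * s⁻¹) / (1 - z * r * s⁻¹)) • (∑ i ∈ Icc 1 n, ∑ j ∈ Icc 1 (i-1), E' n i j ⊗ₖ E' n j i)
  + ((1 - r * s⁻¹) * z / (1 - z * r * s⁻¹)) •
      (∑ i ∈ Icc 1 n, ∑ j ∈ Icc (i+1) n, E' n i j ⊗ₖ E' n j i)

theorem hlp_E (n k l : ℕ) (a b : Fin (2*n)) :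
    E n k l a b = if a.val + 1 = k ∧ b.val + 1 = l then (1 : K) else 0 := rfl

theorem hlp_E' (n k l : ℕ) (a b : Fin n) :
    E' n k l a b = if a.val + 1 = k ∧ b.val + 1 = l then (1 : K) else 0 := rfl

theorem hlp_sum1 (A : Finset ℕ) (f : ℕ → K) (x : ℕ) (v : K)
    (h : ∀ i ∈ A, f i = if i = x then v else 0) :
    ∑ i ∈ A, f i = if x ∈ A then v else 0 := by
  rw [Finset.sum_congr rfl h, Finset.sum_ite_eq']

theorem hlp_sum2 (A : Finset ℕ) (B : ℕ → Finset ℕ) (f : ℕ → ℕ → K) (x y : ℕ) (v : K)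
    (h : ∀ i ∈ A, ∀ j ∈ B i, f i j = if i = x ∧ j = y then v else 0) :
    ∑ i ∈ A, ∑ j ∈ B i, f i j = if x ∈ A ∧ y ∈ B x then v else 0 := by
  rw [hlp_sum1 A _ x (if y ∈ B x then v else 0)]
  · by_cases hx : x ∈ A <;> simp [hx]
  · intro i hi
    by_cases hx : i = x
    · subst hx
      rw [if_pos rfl]
      apply hlp_sum1
      intro j hj
      rw [h i hi j hj]
      simp
    · rw [if_neg hx]
      apply Finset.sum_eq_zero
      intro j hj
      rw [h i hi j hj]
      simp [hx]

theorem hlp_zero2 (A : Finset ℕ) (B : ℕ → Finset ℕ) (f : ℕ → ℕ → K)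
    (h : ∀ i ∈ A, ∀ j ∈ B i, f i j = 0) :
    ∑ i ∈ A, ∑ j ∈ B i, f i j = 0 :=
  Finset.sum_eq_zero fun i hi => Finset.sum_eq_zero fun j hj => h i hi j hj

theorem hlp_s : s ≠ 0 := by
  unfold s σ'
  apply pow_ne_zero
  intro h
  rw [FaithfulSMul.algebraMap_eq_zero_iff] at h
  exact MvPolynomial.X_ne_zero _ h

theorem hlp_div (x z : K) : x / (1 - z * r * s⁻¹) = - (x * s) / (z * r - s) := by
  have hs := hlp_s
  have h : 1 - z * r * s⁻¹ = - ((z * r - s) / s) := by field_simp; ring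
  rw [h, div_neg, div_div_eq_mul_div, neg_div]

theorem hlp_S1 (n : ℕ) (a b c d : Fin (2*n)) (ha : a.val + 1 ≤ n) (hc : c.val + 1 ≤ n) :
    S1 n (a, c) (b, d) = if a < c ∧ a = b ∧ c = d then 1 else 0 := by
  unfold S1
  simp only [Matrix.add_apply, Matrix.sum_apply, Matrix.kroneckerMap_apply, hlp_E]
  rw [hlp_sum2 _ _ _ (a.val+1) (c.val+1) (if a = b ∧ c = d then 1 else 0),
    hlp_zero2, Finset.sum_eq_zero, hlp_zero2, hlp_zero2]
  · simp only [Finset.mem_Icc, add_zero]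
    split_ifs <;> first | rfl | (exfalso; grind)
  all_goals
    intros
    simp only [Finset.mem_Icc, Fin.ext_iff] at *
    split_ifs <;> first | (simp; done) | (exfalso; omega)

theorem hlp_S2 (n : ℕ) (a b c d : Fin (2*n)) (ha : a.val + 1 ≤ n) (hc : c.val + 1 ≤ n) :
    S2 n (a, c) (b, d) = if c < a ∧ a = b ∧ c = d then 1 else 0 := by
  unfold S2
  simp only [Matrix.add_apply, Matrix.sum_apply, Matrix.kroneckerMap_apply, hlp_E]
  rw [hlp_sum2 _ _ _ (c.val+1) (a.val+1) (if a = b ∧ c = d then 1 else 0),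
    hlp_zero2, Finset.sum_eq_zero, hlp_zero2, hlp_zero2]
  · simp only [Finset.mem_Icc, add_zero]
    split_ifs <;> first | rfl | (exfalso; grind)
  all_goals
    intros
    simp only [Finset.mem_Icc, Fin.ext_iff] at *
    split_ifs <;> first | (simp; done) | (exfalso; omega)

theorem hlp_ite (p : Prop) [Decidable p] (n : ℕ) (X : M2 n) (u v : Fin (2*n) × Fin (2*n)) :
    (if p then X else 0) u v = if p then X u v else 0 := by
  split_ifs <;> rfl

theorem hlp_Rbar (n : ℕ) (z : K) (a b c d : Fin (2*n)) (ha : a.val + 1 ≤ n) (hc : c.val + 1 ≤ n) :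
    Rbar n z (a, c) (b, d) = (if a = b ∧ c = d ∧ a = c then 1 else 0)
      + (r * s * (z - 1) / (z * r - s)) * (if a < c ∧ a = b ∧ c = d then 1 else 0)
      + ((z - 1) / (z * r - s)) * (if c < a ∧ a = b ∧ c = d then 1 else 0)
      + ((r - s) / (z * r - s)) * (if c < a ∧ a = d ∧ c = b then 1 else 0)
      + ((r - s) * z / (z * r - s)) * (if a < c ∧ a = d ∧ c = b then 1 else 0) := by
  unfold Rbar
  simp only [Matrix.add_apply, Matrix.smul_apply, smul_eq_mul, hlp_S1 n a b c d ha hc,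
    hlp_S2 n a b c d ha hc]
  simp only [Matrix.sum_apply, Matrix.smul_apply, smul_eq_mul, hlp_ite,
    Matrix.kroneckerMap_apply, hlp_E]
  rw [hlp_sum1 _ _ (a.val+1) (if a = b ∧ c = d ∧ a = c then 1 else 0),
    hlp_sum2 _ _ _ (a.val+1) (c.val+1) (if a = d ∧ c = b then 1 else 0),
    hlp_sum2 _ _ _ (a.val+1) (c.val+1) (if a = d ∧ c = b then 1 else 0), hlp_zero2]
  · have h1 : a.val + 1 ∈ Icc 1 (2*n) := by rw [Finset.mem_Icc]; omega
    have h2 : c.val + 1 ∈ Icc 1 (a.val + 1 - 1) ↔ c < a := by rw [Finset.mem_Icc, Fin.lt_def]; omega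
    have h3 : c.val + 1 ∈ Icc (a.val + 1 + 1) (2*n) ↔ a < c := by rw [Finset.mem_Icc, Fin.lt_def]; omega
    simp only [h1, h2, h3, true_and, if_true, ← ite_and, mul_zero, add_zero]
  all_goals
    intros
    simp only [Finset.mem_Icc, Fin.ext_iff] at *
    split_ifs <;> first | (simp; done) | (exfalso; omega)

theorem hlp_R'A (n : ℕ) (z : K) (a b c d : Fin n) :
    R'A n z (a, c) (b, d) = (if a = b ∧ c = d ∧ a = c then 1 else 0)
      + ((1 - z) * s⁻¹ / (1 - z * r * s⁻¹)) * (if c < a ∧ a = b ∧ c = d then 1 else 0)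
      + ((1 - z) * r / (1 - z * r * s⁻¹)) * (if a < c ∧ a = b ∧ c = d then 1 else 0)
      + ((1 - r * s⁻¹) / (1 - z * r * s⁻¹)) * (if c < a ∧ a = d ∧ c = b then 1 else 0)
      + ((1 - r * s⁻¹) * z / (1 - z * r * s⁻¹)) * (if a < c ∧ a = d ∧ c = b then 1 else 0) := by
  unfold R'A
  simp only [Matrix.add_apply, Matrix.smul_apply, smul_eq_mul, Matrix.sum_apply,
    Matrix.kroneckerMap_apply, hlp_E']
  rw [hlp_sum1 _ _ (a.val+1) (if a = b ∧ c = d ∧ a = c then 1 else 0),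
    hlp_sum2 _ _ _ (a.val+1) (c.val+1) (if a = b ∧ c = d then 1 else 0),
    hlp_sum2 _ _ _ (a.val+1) (c.val+1) (if a = b ∧ c = d then 1 else 0),
    hlp_sum2 _ _ _ (a.val+1) (c.val+1) (if a = d ∧ c = b then 1 else 0),
    hlp_sum2 _ _ _ (a.val+1) (c.val+1) (if a = d ∧ c = b then 1 else 0)]
  · have h1 : a.val + 1 ∈ Icc 1 n := by rw [Finset.mem_Icc]; omega
    have h2 : c.val + 1 ∈ Icc 1 (a.val + 1 - 1) ↔ c < a := by rw [Finset.mem_Icc, Fin.lt_def]; omega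
    have h3 : c.val + 1 ∈ Icc (a.val + 1 + 1) n ↔ a < c := by rw [Finset.mem_Icc, Fin.lt_def]; omega
    simp only [h1, h2, h3, true_and, if_true, ← ite_and]
  all_goals
    intros
    simp only [Finset.mem_Icc, Fin.ext_iff] at *
    split_ifs <;> first | (simp; done) | (exfalso; omega)

/-- the type-`A` block of the spectral `C`-type `R`-matrix. -/
theorem stmt11 (n : ℕ) (hn : 2 ≤ n) (i j k l : ℕ)
    (hi1 : 1 ≤ i) (hi2 : i ≤ n) (hj1 : 1 ≤ j) (hj2 : j ≤ n)
    (hk1 : 1 ≤ k) (hk2 : k ≤ n) (hl1 : 1 ≤ l) (hl2 : l ≤ n)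
    (a b c d : Fin (2*n)) (a' b' c' d' : Fin n)
    (ha : a.val + 1 = i) (hb : b.val + 1 = j) (hc : c.val + 1 = k) (hd : d.val + 1 = l)
    (ha' : a'.val + 1 = i) (hb' : b'.val + 1 = j) (hc' : c'.val + 1 = k) (hd' : d'.val + 1 = l) :
    Rbar n zVar (a, c) (b, d) = R'A n zVar (a', c') (b', d') := by
  rw [hlp_Rbar n zVar a b c d (by omega) (by omega), hlp_R'A]
  have e1 : a.val = a'.val := by omega
  have e2 : b.val = b'.val := by omega
  have e3 : c.val = c'.val := by omega
  have e4 : d.val = d'.val := by omega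
  have hs := hlp_s
  have q1 : -((1 - zVar) * s⁻¹ * s) = zVar - 1 := by field_simp; ring
  have q2 : -((1 - zVar) * r * s) = r * s * (zVar - 1) := by ring
  have q3 : -((1 - r * s⁻¹) * s) = r - s := by field_simp; ring
  have q4 : -((1 - r * s⁻¹) * zVar * s) = (r - s) * zVar := by field_simp; ring
  simp only [hlp_div, q1, q2, q3, q4, Fin.ext_iff, Fin.lt_def, e1, e2, e3, e4]
  ring
end
end
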